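/- Fix λ, μ ∈ ℝ, set δ = μ − λ, let k ≥ 2 be an integer, let F₁, F₂ ∈ A be homogeneous of the same parity F̃, and let f be one of the contact Hamiltonians x², xθ₁, xθ₂ (of parity f̃). Set Q = F₁∂ₓ^k + F₂∂ₓ^{k−1}D̄₁D̄₂ (superfunctions acting by left multiplication). Then, as operators on A, L^μ_{X_f}∘Q − (−1)^{f̃F̃} Q∘L^λ_{X_f} = (L^{δ−k}_{X_f}F₁)∂ₓ^k + (L^{δ−k}_{X_f}F₂)∂ₓ^{k−1}D̄₁D̄₂ + (−1)^{f̃}((−1)^{F̃}(k/2)D̄₁(f′)F₁ + (−1)^{F̃}(k/2 + λ)D̄₂(f′)F₂)∂ₓ^{k−1}D̄₁ + (−1)^{f̃}((−1)^{F̃}(k/2)D̄₂(f′)F₁ − (−1)^{F̃}(k/2 + λ)D̄₁(f′)F₂)∂ₓ^{k−1}D̄₂ − k((k−1)/2 + λ) f″ F₁ ∂ₓ^{k−1} − (k−1)(k/2 + λ) f″ F₂ ∂ₓ^{k−2}D̄₁D̄₂, where f′ = ∂ₓ(f), f″ = ∂ₓ²(f). -/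

import Mathlib

/-! Model of the superfunctions on the supercircle `S^{1|2}`:
quadruples `f = (f₀, f₁, f₂, f₁₂)` of functions `ℝ → ℝ`, thought of as
`f = f₀ + θ₁f₁ + θ₂f₂ + θ₁θ₂f₁₂` with Grassmann relations
`θ₁θ₂ = −θ₂θ₁`, `θ₁² = θ₂² = 0`. -/
abbrev SF : Type := (ℝ → ℝ) × (ℝ → ℝ) × (ℝ → ℝ) × (ℝ → ℝ)

namespace SF

/-- the coefficient `f₀`. -/
def c0 (f : SF) : ℝ → ℝ := f.1
/-- the coefficient `f₁` of `θ₁`. -/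
def c1 (f : SF) : ℝ → ℝ := f.2.1
/-- the coefficient `f₂` of `θ₂`. -/
def c2 (f : SF) : ℝ → ℝ := f.2.2.1
/-- the coefficient `f₁₂` of `θ₁θ₂`. -/
def c12 (f : SF) : ℝ → ℝ := f.2.2.2

/-- a superfunction is smooth if its four components are. -/
def Smooth (f : SF) : Prop :=
  ContDiff ℝ (⊤ : ℕ∞) f.c0 ∧ ContDiff ℝ (⊤ : ℕ∞) f.c1 ∧
    ContDiff ℝ (⊤ : ℕ∞) f.c2 ∧ ContDiff ℝ (⊤ : ℕ∞) f.c12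

/-- the associative product
`(f₀+θ₁f₁+θ₂f₂+θ₁θ₂f₁₂)(g₀+θ₁g₁+θ₂g₂+θ₁θ₂g₁₂)` determined by the
Grassmann relations `θ₁θ₂ = −θ₂θ₁`, `θ₁² = θ₂² = 0`. -/
def mul (f g : SF) : SF :=
  (f.c0 * g.c0,
   f.c0 * g.c1 + f.c1 * g.c0,
   f.c0 * g.c2 + f.c2 * g.c0,
   f.c0 * g.c12 + f.c12 * g.c0 + f.c1 * g.c2 - f.c2 * g.c1)

/-- `∂ₓ` differentiates each component. -/
noncomputable def dx (f : SF) : SF := (deriv f.c0, deriv f.c1, deriv f.c2, deriv f.c12)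

/-- `∂_{θ₁} f = f₁ + θ₂ f₁₂`. -/
def dθ1 (f : SF) : SF := (f.c1, 0, f.c12, 0)

/-- `∂_{θ₂} f = f₂ − θ₁ f₁₂`. -/
def dθ2 (f : SF) : SF := (f.c2, -f.c12, 0, 0)

/-- the odd coordinate `θ₁` as a superfunction. -/
def θ1 : SF := (0, 1, 0, 0)
/-- the odd coordinate `θ₂` as a superfunction. -/
def θ2 : SF := (0, 0, 1, 0)

/-- `D̄₁ = ∂_{θ₁} − θ₁ ∂ₓ`. -/
noncomputable def D1 (f : SF) : SF := dθ1 f - mul θ1 (dx f)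

/-- `D̄₂ = ∂_{θ₂} − θ₂ ∂ₓ`. -/
noncomputable def D2 (f : SF) : SF := dθ2 f - mul θ2 (dx f)

/-- the contact vector field `X_f = f ∂ₓ − (−1)^{f̃} (1/2)(D̄₁(f) D̄₁ + D̄₂(f) D̄₂)`
of a homogeneous contact Hamiltonian `f` of parity `ε`. -/
noncomputable def X (ε : ℕ) (f : SF) (g : SF) : SF :=
  mul f (dx g) -
    ((-1 : ℝ) ^ ε * (1 / 2 : ℝ)) • (mul (D1 f) (D1 g) + mul (D2 f) (D2 g))

/-- `f` is even: `f₁ = f₂ = 0`. -/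
def IsEven (f : SF) : Prop := f.c1 = 0 ∧ f.c2 = 0

/-- `f` is odd: `f₀ = f₁₂ = 0`. -/
def IsOdd (f : SF) : Prop := f.c0 = 0 ∧ f.c12 = 0

/-- `f` is homogeneous of parity `ε`. -/
def Homog (ε : ℕ) (f : SF) : Prop := if ε % 2 = 0 then IsEven f else IsOdd f

/-- the contact Hamiltonian `1`. -/
def hOne : SF := (1, 0, 0, 0)
/-- the contact Hamiltonian `x`. -/
def hX : SF := (fun x => x, 0, 0, 0)
/-- the contact Hamiltonian `θ₁`. -/
def hθ1 : SF := θ1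
/-- the contact Hamiltonian `θ₂`. -/
def hθ2 : SF := θ2
/-- the contact Hamiltonian `θ₁θ₂`. -/
def hθ1θ2 : SF := (0, 0, 0, 1)
/-- the contact Hamiltonian `x²`. -/
def hX2 : SF := (fun x => x ^ 2, 0, 0, 0)
/-- the contact Hamiltonian `xθ₁`. -/
def hXθ1 : SF := (0, fun x => x, 0, 0)
/-- the contact Hamiltonian `xθ₂`. -/
def hXθ2 : SF := (0, 0, fun x => x, 0)

end SF

namespace SF

/-- the Lie derivative `L^ν_{X_f} = X_f + ν f′` on `ν`-densities, for a homogeneous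
contact Hamiltonian `f` of parity `ε` (with `f′ = ∂ₓ(f)` acting by left multiplication). -/
noncomputable def L (ε : ℕ) (f : SF) (ν : ℝ) (g : SF) : SF :=
  X ε f g + ν • mul (dx f) g

end SF

namespace SF

/-- Superfunctions whose four components agree pointwise are equal. -/
theorem eq_of_components {f g : SF} (h0 : ∀ x, f.1 x = g.1 x) (h1 : ∀ x, f.2.1 x = g.2.1 x)
    (h2 : ∀ x, f.2.2.1 x = g.2.2.1 x) (h12 : ∀ x, f.2.2.2 x = g.2.2.2 x) : f = g :=
  Prod.ext (funext h0) (Prod.ext (funext h1) (Prod.ext (funext h2) (funext h12)))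

theorem contDiff_iterate_deriv {u : ℝ → ℝ} (hu : ContDiff ℝ (⊤ : ℕ∞) u) (n : ℕ) :
    ContDiff ℝ (⊤ : ℕ∞) (deriv^[n] u) :=
  ContDiff.iterate_deriv n hu

theorem hasDerivAt_iterate_deriv {u : ℝ → ℝ} (hu : ContDiff ℝ (⊤ : ℕ∞) u) (n : ℕ) (x : ℝ) :
    HasDerivAt (deriv^[n] u) (deriv^[n + 1] u x) x := by
  rw [Function.iterate_succ_apply']
  exact ((contDiff_iterate_deriv hu n).differentiable (by simp)).differentiableAt.hasDerivAt

theorem iterate_deriv_sq_mul_deriv_add {u : ℝ → ℝ} (hu : ContDiff ℝ (⊤ : ℕ∞) u) (c : ℝ)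
    (n : ℕ) :
    deriv^[n + 1] (fun x => x ^ 2 * deriv u x + c * x * u x) = fun x =>
      x ^ 2 * deriv^[n + 2] u x + (2 * n + 2 + c) * x * deriv^[n + 1] u x +
        (n + 1) * (n + c) * deriv^[n] u x := by
  induction n with
  | zero =>
    funext x
    have h0 : HasDerivAt u (deriv u x) x := hasDerivAt_iterate_deriv hu 0 x
    have h1 : HasDerivAt (deriv u) (deriv (deriv u) x) x := hasDerivAt_iterate_deriv hu 1 x
    have := ((hasDerivAt_pow 2 x).mul h1).add (((hasDerivAt_id x).const_mul c).mul h0)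
    refine this.deriv.trans ?_
    simp
    ring
  | succ n ih =>
    rw [Function.iterate_succ_apply', ih]
    funext x
    have := (((hasDerivAt_pow 2 x).mul (hasDerivAt_iterate_deriv hu (n + 2) x)).add
      (((hasDerivAt_id x).const_mul (2 * (n : ℝ) + 2 + c)).mul
        (hasDerivAt_iterate_deriv hu (n + 1) x))).add
      ((hasDerivAt_iterate_deriv hu n x).const_mul (((n : ℝ) + 1) * (n + c)))
    refine this.deriv.trans ?_
    simp only [id, Nat.cast_add, Nat.cast_one, Nat.cast_ofNat, Nat.add_one_sub_one, pow_one,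
      add_assoc, Nat.reduceAdd]
    ring

theorem iterate_deriv_mul_id_add {u w : ℝ → ℝ} (hu : ContDiff ℝ (⊤ : ℕ∞) u)
    (hw : ContDiff ℝ (⊤ : ℕ∞) w) (r s : ℝ) (n : ℕ) :
    deriv^[n + 1] (fun x => r * x * u x + s * w x) = fun x =>
      r * x * deriv^[n + 1] u x + r * (n + 1) * deriv^[n] u x + s * deriv^[n + 1] w x := by
  induction n with
  | zero =>
    funext x
    have h0 : HasDerivAt u (deriv u x) x := hasDerivAt_iterate_deriv hu 0 x
    have h1 : HasDerivAt w (deriv w x) x := hasDerivAt_iterate_deriv hw 0 x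
    have := (((hasDerivAt_id x).const_mul r).mul h0).add (h1.const_mul s)
    refine this.deriv.trans ?_
    simp
    ring
  | succ n ih =>
    rw [Function.iterate_succ_apply', ih]
    funext x
    have := ((((hasDerivAt_id x).const_mul r).mul (hasDerivAt_iterate_deriv hu (n + 1) x)).add
      ((hasDerivAt_iterate_deriv hu n x).const_mul (r * ((n : ℝ) + 1)))).add
      ((hasDerivAt_iterate_deriv hw (n + 1) x).const_mul s)
    refine this.deriv.trans ?_
    simp only [id, Nat.cast_add, Nat.cast_one]
    ring

theorem dx_iterate (n : ℕ) (f : SF) :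
    dx^[n] f = (deriv^[n] f.1, deriv^[n] f.2.1, deriv^[n] f.2.2.1, deriv^[n] f.2.2.2) := by
  induction n with
  | zero => rfl
  | succ n ih => simp only [Function.iterate_succ_apply', ih]; rfl

theorem Smooth.dx_iterate {f : SF} (hf : Smooth f) (n : ℕ) : Smooth (dx^[n] f) := by
  rw [SF.dx_iterate]
  exact ⟨contDiff_iterate_deriv hf.1 n, contDiff_iterate_deriv hf.2.1 n,
    contDiff_iterate_deriv hf.2.2.1 n, contDiff_iterate_deriv hf.2.2.2 n⟩

theorem Smooth.mul {f g : SF} (hf : Smooth f) (hg : Smooth g) : Smooth (mul f g) := by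
  obtain ⟨f0, f1, f2, f3⟩ := hf
  obtain ⟨g0, g1, g2, g3⟩ := hg
  exact ⟨f0.mul g0, (f0.mul g1).add (f1.mul g0), (f0.mul g2).add (f2.mul g0),
    (((f0.mul g3).add (f3.mul g0)).add (f1.mul g2)).sub (f2.mul g1)⟩

theorem D1_eq (f : SF) : D1 f = (f.2.1, -deriv f.1, f.2.2.2, -deriv f.2.2.1) := by
  apply eq_of_components <;> intro x <;> simp [D1, dθ1, θ1, mul, dx, c0, c1, c2, c12]

theorem D2_eq (f : SF) : D2 f = (f.2.2.1, -f.2.2.2, -deriv f.1, deriv f.2.1) := by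
  apply eq_of_components <;> intro x <;> simp [D2, dθ2, θ2, mul, dx, c0, c1, c2, c12]

theorem D1_D2_eq (f : SF) :
    D1 (D2 f) = (-f.2.2.2, -deriv f.2.2.1, deriv f.2.1, deriv (deriv f.1)) := by
  apply eq_of_components <;> intro x <;> simp [D1_eq, D2_eq, deriv.neg']

theorem Smooth.D1_D2 {f : SF} (hf : Smooth f) : Smooth (D1 (D2 f)) := by
  rw [D1_D2_eq]
  exact ⟨hf.2.2.2.neg, (contDiff_iterate_deriv hf.2.2.1 1).neg, contDiff_iterate_deriv hf.2.1 1,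
    contDiff_iterate_deriv hf.1 2⟩

theorem Smooth.differentiableAt {f : SF} (hf : Smooth f) (x : ℝ) :
    DifferentiableAt ℝ f.1 x ∧ DifferentiableAt ℝ f.2.1 x ∧
      DifferentiableAt ℝ f.2.2.1 x ∧ DifferentiableAt ℝ f.2.2.2 x :=
  ⟨hf.1.differentiable (by simp) x, hf.2.1.differentiable (by simp) x,
    hf.2.2.1.differentiable (by simp) x, hf.2.2.2.differentiable (by simp) x⟩

theorem dx_add {f g : SF} (hf : Smooth f) (hg : Smooth g) : dx (f + g) = dx f + dx g := by
  apply eq_of_components <;> intro x <;> obtain ⟨f0, f1, f2, f3⟩ := hf.differentiableAt x <;>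
    obtain ⟨g0, g1, g2, g3⟩ := hg.differentiableAt x
  exacts [deriv_add f0 g0, deriv_add f1 g1, deriv_add f2 g2, deriv_add f3 g3]

theorem dx_mul {f g : SF} (hf : Smooth f) (hg : Smooth g) :
    dx (mul f g) = mul (dx f) g + mul f (dx g) := by
  apply eq_of_components <;> intro x <;> obtain ⟨f0, f1, f2, f3⟩ := hf.differentiableAt x <;>
    obtain ⟨g0, g1, g2, g3⟩ := hg.differentiableAt x
  · refine (f0.hasDerivAt.mul g0.hasDerivAt).deriv.trans ?_
    simp [mul, dx, c0]
  · refine ((f0.hasDerivAt.mul g1.hasDerivAt).add (f1.hasDerivAt.mul g0.hasDerivAt)).deriv.trans ?_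
    simp [mul, dx, c0, c1]
    ring
  · refine ((f0.hasDerivAt.mul g2.hasDerivAt).add (f2.hasDerivAt.mul g0.hasDerivAt)).deriv.trans ?_
    simp [mul, dx, c0, c2]
    ring
  · refine ((((f0.hasDerivAt.mul g3.hasDerivAt).add (f3.hasDerivAt.mul g0.hasDerivAt)).add
      (f1.hasDerivAt.mul g2.hasDerivAt)).sub (f2.hasDerivAt.mul g1.hasDerivAt)).deriv.trans ?_
    simp [mul, dx, c0, c1, c2, c12]
    ring

theorem L_hX2 (ν : ℝ) (g : SF) :
    L 0 hX2 ν g = (fun x => x ^ 2 * deriv g.1 x + (2 * ν) * x * g.1 x,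
      fun x => x ^ 2 * deriv g.2.1 x + (2 * ν + 1) * x * g.2.1 x,
      fun x => x ^ 2 * deriv g.2.2.1 x + (2 * ν + 1) * x * g.2.2.1 x,
      fun x => x ^ 2 * deriv g.2.2.2 x + (2 * ν + 2) * x * g.2.2.2 x) := by
  apply eq_of_components <;> intro x <;>
    simp [L, X, hX2, D1_eq, D2_eq, mul, dx, c0, c1, c2, c12] <;> ring

theorem L_hXθ1 (ν : ℝ) (g : SF) :
    L 1 hXθ1 ν g = (fun x => 1 / 2 * x * g.2.1 x + 0 * g.1 x,
      fun x => 1 / 2 * x * deriv g.1 x + ν * g.1 x,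
      fun x => 1 / 2 * x * g.2.2.2 x + 0 * g.1 x,
      fun x => 1 / 2 * x * deriv g.2.2.1 x + (ν + 1 / 2) * g.2.2.1 x) := by
  apply eq_of_components <;> intro x <;>
    simp [L, X, hXθ1, D1_eq, D2_eq, mul, dx, c0, c1, c2, c12] <;> ring

theorem L_hXθ2 (ν : ℝ) (g : SF) :
    L 1 hXθ2 ν g = (fun x => 1 / 2 * x * g.2.2.1 x + 0 * g.1 x,
      fun x => -1 / 2 * x * g.2.2.2 x + 0 * g.1 x,
      fun x => 1 / 2 * x * deriv g.1 x + ν * g.1 x,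
      fun x => -1 / 2 * x * deriv g.2.1 x + -(ν + 1 / 2) * g.2.1 x) := by
  apply eq_of_components <;> intro x <;>
    simp [L, X, hXθ2, D1_eq, D2_eq, mul, dx, c0, c1, c2, c12] <;> ring

theorem iterate_deriv_neg (n : ℕ) (u : ℝ → ℝ) : deriv^[n] (-u) = -deriv^[n] u := by
  induction n with
  | zero => rfl
  | succ n ih => simp only [Function.iterate_succ_apply', ih, deriv.neg']; rfl

theorem dx_iterate_D1 (n : ℕ) (f : SF) :
    dx^[n] (D1 f) = (deriv^[n] f.2.1, -deriv^[n + 1] f.1, deriv^[n] f.2.2.2,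
      -deriv^[n + 1] f.2.2.1) := by
  simp only [D1_eq, dx_iterate, iterate_deriv_neg, Function.iterate_succ_apply]

theorem dx_iterate_D2 (n : ℕ) (f : SF) :
    dx^[n] (D2 f) = (deriv^[n] f.2.2.1, -deriv^[n] f.2.2.2, -deriv^[n + 1] f.1,
      deriv^[n + 1] f.2.1) := by
  simp only [D2_eq, dx_iterate, iterate_deriv_neg, Function.iterate_succ_apply]

theorem dx_iterate_D1_D2 (n : ℕ) (f : SF) :
    dx^[n] (D1 (D2 f)) = (-deriv^[n] f.2.2.2, -deriv^[n + 1] f.2.2.1, deriv^[n + 1] f.2.1,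
      deriv^[n + 2] f.1) := by
  simp only [D1_D2_eq, dx_iterate, iterate_deriv_neg, Function.iterate_succ_apply]

theorem dx_hX2 : dx hX2 = (fun x => 2 * x, 0, 0, 0) := by
  apply eq_of_components <;> intro x <;> simp [dx, hX2, c0, c1, c2, c12]

theorem dx_hXθ1 : dx hXθ1 = (0, 1, 0, 0) := by
  apply eq_of_components <;> intro x <;> simp [dx, hXθ1, c0, c1, c2, c12]

theorem dx_hXθ2 : dx hXθ2 = (0, 0, 1, 0) := by
  apply eq_of_components <;> intro x <;> simp [dx, hXθ2, c0, c1, c2, c12]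

end SF

set_option maxHeartbeats 4000000 in
open SF in
/-- For `f ∈ {x², xθ₁, xθ₂}` of parity `f̃`, `k ≥ 2` an integer, `F₁, F₂` smooth
homogeneous of the same parity `F̃`, `δ = μ − λ` and
`Q = F₁∂ₓ^k + F₂∂ₓ^{k−1}D̄₁D̄₂`, the operator
`L^μ_{X_f}∘Q − (−1)^{f̃F̃} Q∘L^λ_{X_f}` equals
`(L^{δ−k}_{X_f}F₁)∂ₓ^k + (L^{δ−k}_{X_f}F₂)∂ₓ^{k−1}D̄₁D̄₂
+ (−1)^{f̃}((−1)^{F̃}(k/2)D̄₁(f′)F₁ + (−1)^{F̃}(k/2+λ)D̄₂(f′)F₂)∂ₓ^{k−1}D̄₁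
+ (−1)^{f̃}((−1)^{F̃}(k/2)D̄₂(f′)F₁ − (−1)^{F̃}(k/2+λ)D̄₁(f′)F₂)∂ₓ^{k−1}D̄₂
− k((k−1)/2+λ) f″F₁ ∂ₓ^{k−1} − (k−1)(k/2+λ) f″F₂ ∂ₓ^{k−2}D̄₁D̄₂` on `A`. -/
theorem gamma_integer_degree (lam μ : ℝ) (k : ℕ) (hk : 2 ≤ k)
    (F1 F2 : SF) (Fε : ℕ) (hF1s : Smooth F1) (hF2s : Smooth F2)
    (hF1 : Homog Fε F1) (hF2 : Homog Fε F2)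
    (f : SF) (fε : ℕ)
    (hf : (f, fε) = (hX2, 0) ∨ (f, fε) = (hXθ1, 1) ∨ (f, fε) = (hXθ2, 1)) :
    ∀ g : SF, Smooth g →
      L fε f μ (mul F1 (dx^[k] g) + mul F2 (dx^[k - 1] (D1 (D2 g)))) -
        ((-1 : ℝ) ^ (fε * Fε)) •
          (mul F1 (dx^[k] (L fε f lam g)) + mul F2 (dx^[k - 1] (D1 (D2 (L fε f lam g))))) =
      mul (L fε f (μ - lam - (k : ℝ)) F1) (dx^[k] g) +
      mul (L fε f (μ - lam - (k : ℝ)) F2) (dx^[k - 1] (D1 (D2 g))) +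
      ((-1 : ℝ) ^ fε) •
        mul (((-1 : ℝ) ^ Fε * ((k : ℝ) / 2)) • mul (D1 (dx f)) F1 +
             ((-1 : ℝ) ^ Fε * ((k : ℝ) / 2 + lam)) • mul (D2 (dx f)) F2)
          (dx^[k - 1] (D1 g)) +
      ((-1 : ℝ) ^ fε) •
        mul (((-1 : ℝ) ^ Fε * ((k : ℝ) / 2)) • mul (D2 (dx f)) F1 -
             ((-1 : ℝ) ^ Fε * ((k : ℝ) / 2 + lam)) • mul (D1 (dx f)) F2)
          (dx^[k - 1] (D2 g)) -
      ((k : ℝ) * (((k : ℝ) - 1) / 2 + lam)) • mul (mul (dx (dx f)) F1) (dx^[k - 1] g) -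
      (((k : ℝ) - 1) * ((k : ℝ) / 2 + lam)) • mul (mul (dx (dx f)) F2) (dx^[k - 2] (D1 (D2 g))) := by
  intro g hg
  obtain ⟨m, rfl⟩ := Nat.exists_eq_add_of_le' hk
  have hdx : dx (mul F1 (dx^[m + 2] g) + mul F2 (dx^[m + 1] (D1 (D2 g)))) =
      mul (dx F1) (dx^[m + 2] g) + mul F1 (dx^[m + 3] g) +
        (mul (dx F2) (dx^[m + 1] (D1 (D2 g))) + mul F2 (dx^[m + 2] (D1 (D2 g)))) := by
    rw [dx_add (hF1s.mul (hg.dx_iterate _)) (hF2s.mul (hg.D1_D2.dx_iterate _)),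
      dx_mul hF1s (hg.dx_iterate _), dx_mul hF2s (hg.D1_D2.dx_iterate _),
      Function.iterate_succ_apply' _ (m + 2), Function.iterate_succ_apply' _ (m + 1) (D1 _)]
  have e0 := congrArg (fun f : SF => f.1) hdx
  have e1 := congrArg (fun f : SF => f.2.1) hdx
  have e2 := congrArg (fun f : SF => f.2.2.1) hdx
  have e3 := congrArg (fun f : SF => f.2.2.2) hdx
  rw [show m + 2 - 1 = m + 1 from rfl, show m + 2 - 2 = m from rfl]
  generalize hQ : mul F1 (dx^[m + 2] g) + mul F2 (dx^[m + 1] (D1 (D2 g))) = Q at *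
  simp only [dx, c0, c1, c2, c12] at e0 e1 e2 e3
  obtain ⟨a, b, c, d⟩ := g
  obtain ⟨p0, p1, p2, p3⟩ := F1
  obtain ⟨q0, q1, q2, q3⟩ := F2
  obtain ⟨ha, hb, hc, hd⟩ := hg
  simp only [c0, c1, c2, c12] at ha hb hc hd
  have ha' : ContDiff ℝ (⊤ : ℕ∞) (deriv a) := contDiff_iterate_deriv ha 1
  have hb' : ContDiff ℝ (⊤ : ℕ∞) (deriv b) := contDiff_iterate_deriv hb 1
  have hc' : ContDiff ℝ (⊤ : ℕ∞) (deriv c) := contDiff_iterate_deriv hc 1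
  have hpar : ((-1 : ℝ) ^ Fε = 1 ∧ p1 = 0 ∧ p2 = 0 ∧ q1 = 0 ∧ q2 = 0) ∨
      ((-1 : ℝ) ^ Fε = -1 ∧ p0 = 0 ∧ p3 = 0 ∧ q0 = 0 ∧ q3 = 0) := by
    rcases Nat.mod_two_eq_zero_or_one Fε with h | h
    · simp only [Homog, h, IsEven, if_true] at hF1 hF2
      exact Or.inl ⟨(Nat.even_iff.2 h).neg_one_pow, hF1.1, hF1.2, hF2.1, hF2.2⟩
    · simp only [Homog, h, IsOdd, one_ne_zero, if_false] at hF1 hF2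
      exact Or.inr ⟨(Nat.odd_iff.2 h).neg_one_pow, hF1.1, hF1.2, hF2.1, hF2.2⟩
  clear hF1 hF2
  rcases hf with hf | hf | hf <;> obtain ⟨rfl, rfl⟩ := Prod.mk.inj hf <;>
  [rw [L_hX2 μ Q, e0, e1, e2, e3, dx_hX2];
   rw [L_hXθ1 μ Q, e0, e2, dx_hXθ1];
   rw [L_hXθ2 μ Q, e0, e1, dx_hXθ2]] <;>
  subst hQ <;>
  rcases hpar with ⟨hs, rfl, rfl, rfl, rfl⟩ | ⟨hs, rfl, rfl, rfl, rfl⟩ <;>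
  simp only [zero_mul, one_mul, hs, pow_zero, pow_one] <;>
  simp only [dx_iterate_D1_D2] <;>
  simp only [dx_iterate_D1, dx_iterate_D2] <;>
  simp only [dx_iterate, L_hX2, L_hXθ1, L_hXθ2,
      iterate_deriv_sq_mul_deriv_add ha, iterate_deriv_sq_mul_deriv_add hb,
      iterate_deriv_sq_mul_deriv_add hc, iterate_deriv_sq_mul_deriv_add hd,
      iterate_deriv_mul_id_add ha' ha, iterate_deriv_mul_id_add hb ha,
      iterate_deriv_mul_id_add hd ha,
      iterate_deriv_mul_id_add hc ha,
      iterate_deriv_mul_id_add hb' hb,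
      iterate_deriv_mul_id_add hc' hc] <;>
  simp only [← Function.iterate_succ_apply (f := deriv), Nat.succ_eq_add_one,
      add_assoc, Nat.reduceAdd] <;>
  apply eq_of_components <;> intro x <;>
  simp [mul, D1_eq, D2_eq, dx, c0, c1, c2, c12] <;> ring
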